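/- arXiv:2309.00068 — 2 statements merged into one kernel-verified Lean document; each statement's English description precedes it below -/
import Mathlib

section
/- Let d ≥ 2. There is a constant C, independent of n, such that for every integer n ≥ 0, every f, and every x ∈ ℝ^d, sup_{2^{−n} ≤ t ≤ 2^{−n+1}} |A_t P_{<n} f(x)| ≤ C M_{HL} f(x), where M_{HL} is the Hardy–Littlewood maximal operator on ℝ^d. -/
open MeasureTheory Metric Complex Set Pointwise
open scoped FourierTransform ENNReal NNReal

noncomputable section

/-- The (unnormalized) surface measure on the unit sphere `S^{d-1} ⊆ ℝ^d`. -/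
def sphereMeasure (d : ℕ) : Measure (Metric.sphere (0 : EuclideanSpace ℝ (Fin d)) 1) :=
  (volume : Measure (EuclideanSpace ℝ (Fin d))).toSphere

/-- Spherical average `A_t f(x) = ∫_{S^{d-1}} f(x - ty) dσ(y)`, where `dσ` is the
normalized surface measure on the unit sphere. -/
def sphAvg (d : ℕ) (f : EuclideanSpace ℝ (Fin d) → ℂ) (t : ℝ)
    (x : EuclideanSpace ℝ (Fin d)) : ℂ :=
  ⨍ y, f (x - t • (y : EuclideanSpace ℝ (Fin d))) ∂(sphereMeasure d)

/-- Global spherical maximal function `Mf(x) = sup_{t>0} |A_t f(x)|`. -/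
def sphMax (d : ℕ) (f : EuclideanSpace ℝ (Fin d) → ℂ)
    (x : EuclideanSpace ℝ (Fin d)) : ℝ≥0∞ :=
  ⨆ (t : ℝ) (_ : 0 < t), (‖sphAvg d f t x‖₊ : ℝ≥0∞)

/-- Local spherical maximal function `M_c f(x) = sup_{1<t<2} |A_t f(x)|`. -/
def sphMaxLoc (d : ℕ) (f : EuclideanSpace ℝ (Fin d) → ℂ)
    (x : EuclideanSpace ℝ (Fin d)) : ℝ≥0∞ :=
  ⨆ (t : ℝ) (_ : t ∈ Ioo (1:ℝ) 2), (‖sphAvg d f t x‖₊ : ℝ≥0∞)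

/-- Littlewood–Paley projection `P_j`, determined by `(P_j f)^(ξ) = χ(|ξ|/2^j) f̂(ξ)`. -/
def proj (d : ℕ) (χ : ℝ → ℝ) (j : ℤ) (f : EuclideanSpace ℝ (Fin d) → ℂ) :
    EuclideanSpace ℝ (Fin d) → ℂ :=
  𝓕⁻ (fun ξ => (χ (‖ξ‖ / 2 ^ j) : ℂ) * 𝓕 f ξ)

/-- Projection `P_{<n}`, determined by `(P_{<n} f)^(ξ) = (Σ_{j<n} χ(|ξ|/2^j)) f̂(ξ)`. -/
def projLT (d : ℕ) (χ : ℝ → ℝ) (n : ℤ) (f : EuclideanSpace ℝ (Fin d) → ℂ) :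
    EuclideanSpace ℝ (Fin d) → ℂ :=
  𝓕⁻ (fun ξ => ((∑' j : ℤ, if j < n then χ (‖ξ‖ / 2 ^ j) else 0 : ℝ) : ℂ) * 𝓕 f ξ)

/-- The weight `|x|^{1-d}`, as an `ℝ≥0∞`-valued function. -/
def wt (d : ℕ) (x : EuclideanSpace ℝ (Fin d)) : ℝ≥0∞ :=
  ENNReal.ofReal (‖x‖ ^ ((1:ℝ) - d))

/-- The Hardy–Littlewood maximal function. -/
def hlMax (d : ℕ) (f : EuclideanSpace ℝ (Fin d) → ℂ)
    (x : EuclideanSpace ℝ (Fin d)) : ℝ≥0∞ :=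
  ⨆ (r : ℝ) (_ : 0 < r), (volume (ball x r))⁻¹ * ∫⁻ y in ball x r, (‖f y‖₊ : ℝ≥0∞)

/-- The profile of the low-frequency cutoff. -/
def lfCut (χ : ℝ → ℝ) (u : ℝ) : ℝ := if u < 4/5 then 1 else χ (2 * u)

lemma lf_chi_zero_left {χ : ℝ → ℝ}
    (hχsupp : Function.support χ ⊆ Ioo (1 - 1/100 : ℝ) (2 + 1/100)) {s : ℝ} (hs : s ≤ 99/100) :
    χ s = 0 := by
  by_contra h
  have := (hχsupp h).1
  linarith

lemma lf_chi_zero_right {χ : ℝ → ℝ}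
    (hχsupp : Function.support χ ⊆ Ioo (1 - 1/100 : ℝ) (2 + 1/100)) {s : ℝ} (hs : 201/100 ≤ s) :
    χ s = 0 := by
  by_contra h
  have := (hχsupp h).2
  linarith

lemma lf_tsum {χ : ℝ → ℝ}
    (hχsupp : Function.support χ ⊆ Ioo (1 - 1/100 : ℝ) (2 + 1/100))
    (hχsum : ∀ s : ℝ, 0 < s → HasSum (fun j : ℤ => χ (s / 2 ^ j)) 1) (n : ℤ) {s : ℝ}
    (hs : 0 < s) :
    (∑' j : ℤ, if j < n then χ (s / 2 ^ j) else 0) = lfCut χ (s / 2 ^ n) := by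
  unfold lfCut
  split_ifs with h
  · rw [← (hχsum s hs).tsum_eq]
    congr 1
    ext j
    split_ifs with hj
    · rfl
    · symm
      apply lf_chi_zero_left hχsupp
      have h1 : (2:ℝ) ^ n ≤ 2 ^ j := zpow_le_zpow_right₀ (by norm_num) (by omega)
      have h2 : s / 2 ^ j ≤ s / 2 ^ n := by gcongr
      linarith
  · rw [tsum_eq_single (n - 1)]
    · rw [if_pos (by omega), zpow_sub_one₀ (by norm_num)]
      congr 1
      field_simp
    · intro j hj
      split_ifs with hjn
      · apply lf_chi_zero_right hχsupp
        have h1 : (2:ℝ) ^ j ≤ 2 ^ (n - 2) := zpow_le_zpow_right₀ (by norm_num) (by omega)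
        have h2 : s / 2 ^ (n - 2) ≤ s / 2 ^ j := by gcongr
        have h3 : s / (2:ℝ) ^ (n - 2) = 4 * (s / 2 ^ n) := by
          rw [zpow_sub₀ (by norm_num)]
          field_simp
          norm_num
        linarith
      · rfl

lemma lf_chi_one {χ : ℝ → ℝ}
    (hχsupp : Function.support χ ⊆ Ioo (1 - 1/100 : ℝ) (2 + 1/100))
    (hχsum : ∀ s : ℝ, 0 < s → HasSum (fun j : ℤ => χ (s / 2 ^ j)) 1) {u : ℝ}
    (h1 : 3/5 < u) (h2 : u < 4/5) : χ (2 * u) = 1 := by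
  have h := (hχsum (2 * u) (by linarith)).tsum_eq
  rw [tsum_eq_single 0] at h
  · simpa using h
  · intro j hj
    rcases lt_or_gt_of_ne hj with hj | hj
    · apply lf_chi_zero_right hχsupp
      have h3 : (2:ℝ) ^ j ≤ 2 ^ (-1 : ℤ) := zpow_le_zpow_right₀ (by norm_num) (by omega)
      have h4 : 2 * u / 2 ^ (-1 : ℤ) ≤ 2 * u / 2 ^ j := by gcongr
      norm_num at h4
      linarith
    · apply lf_chi_zero_left hχsupp
      have h3 : (2:ℝ) ^ (1 : ℤ) ≤ 2 ^ j := zpow_le_zpow_right₀ (by norm_num) (by omega)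
      have h4 : 2 * u / 2 ^ j ≤ 2 * u / 2 ^ (1 : ℤ) := by gcongr
      norm_num at h4
      linarith

/-- The low-frequency multiplier as a function on space. -/
def lfMul (d : ℕ) (χ : ℝ → ℝ) (ξ : EuclideanSpace ℝ (Fin d)) : ℂ := (lfCut χ ‖ξ‖ : ℂ)

lemma lfMul_contDiff (d : ℕ) {χ : ℝ → ℝ} (hχsm : ContDiff ℝ (⊤ : ℕ∞) χ)
    (hχsupp : Function.support χ ⊆ Ioo (1 - 1/100 : ℝ) (2 + 1/100))
    (hχsum : ∀ s : ℝ, 0 < s → HasSum (fun j : ℤ => χ (s / 2 ^ j)) 1) :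
    ContDiff ℝ (⊤ : ℕ∞) (lfMul d χ) := by
  rw [contDiff_iff_contDiffAt]
  intro ξ
  by_cases h : ‖ξ‖ < 4/5
  · have : lfMul d χ =ᶠ[nhds ξ] fun _ => (1 : ℂ) := by
      filter_upwards [(continuous_norm.isOpen_preimage _ isOpen_Iio).mem_nhds
        (show ξ ∈ norm ⁻¹' (Iio (4/5 : ℝ)) from h)] with y hy
      have hy' : ‖y‖ < 4/5 := hy
      simp [lfMul, lfCut, hy']
    exact contDiffAt_const.congr_of_eventuallyEq this
  · have : lfMul d χ =ᶠ[nhds ξ] fun y => ((χ (2 * ‖y‖) : ℝ) : ℂ) := by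
      filter_upwards [(continuous_norm.isOpen_preimage _ isOpen_Ioi).mem_nhds
        (show ξ ∈ norm ⁻¹' (Ioi (3/5 : ℝ)) by
          simp only [mem_preimage, mem_Ioi]; linarith)] with y hy
      have hy' : 3/5 < ‖y‖ := hy
      unfold lfMul lfCut
      split_ifs with h5
      · rw [lf_chi_one hχsupp hχsum hy' h5]
      · rfl
    refine ContDiffAt.congr_of_eventuallyEq ?_ this
    have h0 : ξ ≠ 0 := by
      rintro rfl
      norm_num at h
    have hn : ContDiffAt ℝ (⊤ : ℕ∞) (fun y : EuclideanSpace ℝ (Fin d) => 2 * ‖y‖) ξ :=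
      contDiffAt_const.mul (contDiffAt_norm ℝ h0)
    exact (Complex.ofRealCLM.contDiff.contDiffAt).comp ξ (hχsm.contDiffAt.comp ξ hn)

lemma lfMul_compact (d : ℕ) {χ : ℝ → ℝ}
    (hχsupp : Function.support χ ⊆ Ioo (1 - 1/100 : ℝ) (2 + 1/100)) :
    HasCompactSupport (lfMul d χ) := by
  apply HasCompactSupport.of_support_subset_isCompact (isCompact_closedBall 0 2)
  intro ξ hξ
  rw [mem_closedBall_zero_iff]
  by_contra hc
  apply hξ
  unfold lfMul lfCut
  rw [if_neg (by linarith), lf_chi_zero_right hχsupp (by linarith)]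
  simp

lemma lf_kernel_bound (d : ℕ) {χ : ℝ → ℝ} (hχsm : ContDiff ℝ (⊤ : ℕ∞) χ)
    (hχsupp : Function.support χ ⊆ Ioo (1 - 1/100 : ℝ) (2 + 1/100))
    (hχsum : ∀ s : ℝ, 0 < s → HasSum (fun j : ℤ => χ (s / 2 ^ j)) 1) :
    ∃ A : ℝ, 0 < A ∧ ∀ z, (1 + ‖z‖) ^ (d + 1) * ‖𝓕⁻ (lfMul d χ) z‖ ≤ A := by
  let Φ := (lfMul_compact d hχsupp).toSchwartzMap (lfMul_contDiff d hχsm hχsupp hχsum)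
  refine ⟨_, ?_, fun z => le_trans (b := 2 ^ (d + 1) * ((Finset.Iic (d + 1, 0)).sup
    fun m => SchwartzMap.seminorm ℝ m.1 m.2) (𝓕⁻ Φ)) ?_ (le_max_left _ 1)⟩
  · positivity
  · have := SchwartzMap.one_add_le_sup_seminorm_apply (𝕜 := ℝ) (m := (d + 1, 0))
      (k := d + 1) (n := 0) le_rfl le_rfl (𝓕⁻ Φ) z
    rw [norm_iteratedFDeriv_zero, SchwartzMap.fourierInv_coe] at this
    exact this

open Real in
lemma lf_kernel_scale (d : ℕ) (χ : ℝ → ℝ) {N : ℝ} (hN : 0 < N) (z : EuclideanSpace ℝ (Fin d)) :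
    𝓕⁻ (fun ξ => lfMul d χ (N⁻¹ • ξ)) z = ((N ^ d : ℝ) : ℂ) * 𝓕⁻ (lfMul d χ) (N • z) := by
  rw [Real.fourierInv_eq, Real.fourierInv_eq]
  have := Measure.integral_comp_inv_smul_of_nonneg (volume : Measure (EuclideanSpace ℝ (Fin d)))
    (fun v => 𝐞 (inner ℝ v (N • z)) • lfMul d χ v) hN.le
  rw [finrank_euclideanSpace_fin] at this
  rw [← smul_eq_mul, Complex.coe_smul, ← this]
  congr 1
  ext v
  rw [inner_smul_left, inner_smul_right]
  congr 3
  simp only [conj_trivial]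
  field_simp

open Real in
lemma lf_proj_eq (d : ℕ) {m : EuclideanSpace ℝ (Fin d) → ℂ} (hm : Integrable m)
    {f : EuclideanSpace ℝ (Fin d) → ℂ} (hf : Integrable f) (w : EuclideanSpace ℝ (Fin d)) :
    𝓕⁻ (fun ξ => m ξ * 𝓕 f ξ) w = ∫ z, f z * 𝓕⁻ m (w - z) := by
  have hg : Integrable (fun ξ => 𝐞 (inner ℝ ξ w) • m ξ) := by
    have := (Real.fourierIntegral_convergent_iff (μ := volume) (-w)).2 hm
    simpa using this
  have key := VectorFourier.integral_fourierIntegral_smul_eq_flip (μ := volume) (ν := volume)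
    (L := innerₗ (EuclideanSpace ℝ (Fin d))) Real.continuous_fourierChar
    continuous_inner hf hg
  rw [Real.fourierInv_eq]
  calc _ = _ := ?_
    _ = _ := key
    _ = _ := ?_
  · congr 1
    ext ξ
    change _ = 𝓕 f ξ • _
    simp only [Circle.smul_def, smul_eq_mul]
    ring
  · congr 1
    ext z
    rw [Real.fourierInv_eq, smul_eq_mul]
    congr 1
    unfold VectorFourier.fourierIntegral
    congr 1
    ext ξ
    rw [smul_smul, ← AddChar.map_add_eq_mul]
    congr 2
    simp [inner_sub_right]
    rw [real_inner_comm]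
    ring

lemma lf_ball_le (d : ℕ) (f : EuclideanSpace ℝ (Fin d) → ℂ) (x : EuclideanSpace ℝ (Fin d))
    {r : ℝ} (hr : 0 < r) :
    ∫⁻ y in ball x r, (‖f y‖₊ : ℝ≥0∞) ≤
      ENNReal.ofReal (r ^ d) * volume (ball (0 : EuclideanSpace ℝ (Fin d)) 1) * hlMax d f x := by
  have h1 : (volume (ball x r))⁻¹ * ∫⁻ y in ball x r, (‖f y‖₊ : ℝ≥0∞) ≤ hlMax d f x :=
    le_iSup₂_of_le (f := fun (r : ℝ) (_ : 0 < r) =>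
      (volume (ball x r))⁻¹ * ∫⁻ y in ball x r, (‖f y‖₊ : ℝ≥0∞)) r hr le_rfl
  have h2 := Measure.addHaar_ball_of_pos (volume : Measure (EuclideanSpace ℝ (Fin d))) x hr
  rw [finrank_euclideanSpace_fin] at h2
  rw [← h2]
  have h0 : volume (ball x r) ≠ 0 := (measure_ball_pos volume x hr).ne'
  have ht : volume (ball x r) ≠ ⊤ := measure_ball_lt_top.ne
  calc _ = volume (ball x r) * ((volume (ball x r))⁻¹ * ∫⁻ y in ball x r, (‖f y‖₊ : ℝ≥0∞)) := by
        rw [← mul_assoc, ENNReal.mul_inv_cancel h0 ht, one_mul]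
    _ ≤ _ := by gcongr

lemma lf_exists_dyadic {u : ℝ} (hu : 0 ≤ u) (d : ℕ) :
    ∃ k : ℕ, u < 2 ^ k ∧ ((1 + u) ^ (d + 1))⁻¹ ≤ 2 ^ (d + 1) * ((2 ^ k) ^ (d + 1))⁻¹ := by
  classical
  have hex : ∃ k : ℕ, u < 2 ^ k := pow_unbounded_of_one_lt u (by norm_num)
  refine ⟨Nat.find hex, Nat.find_spec hex, ?_⟩
  have hle : (2:ℝ) ^ (Nat.find hex) ≤ 2 * (1 + u) := by
    rcases Nat.eq_zero_or_pos (Nat.find hex) with h | h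
    · rw [h]; norm_num; linarith
    · have := Nat.find_min hex (m := Nat.find hex - 1) (by omega)
      rw [not_lt] at this
      have e : (2:ℝ) ^ (Nat.find hex) = 2 * 2 ^ (Nat.find hex - 1) := by
        rw [← pow_succ']; congr 1; omega
      rw [e]; linarith
  have h3 : ((2:ℝ) ^ (Nat.find hex)) ^ (d + 1) ≤ 2 ^ (d + 1) * (1 + u) ^ (d + 1) := by
    rw [← mul_pow]; gcongr
  have p1 : 0 < (1 + u) ^ (d + 1) := by positivity
  have p2 : 0 < ((2:ℝ) ^ (Nat.find hex)) ^ (d + 1) := by positivity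
  rw [← div_eq_mul_inv, inv_eq_one_div, div_le_div_iff₀ p1 p2]
  linarith

lemma lf_dyadic (d : ℕ) {f : EuclideanSpace ℝ (Fin d) → ℂ} (hf : AEStronglyMeasurable f volume)
    (x : EuclideanSpace ℝ (Fin d)) {N : ℝ} (hN : 0 < N) :
    ∫⁻ z, ENNReal.ofReal (N ^ d * ((1 + N * ‖x - z‖) ^ (d + 1))⁻¹) * (‖f z‖₊ : ℝ≥0∞) ≤
      ENNReal.ofReal (2 ^ (d + 1) * 2) * volume (ball (0 : EuclideanSpace ℝ (Fin d)) 1)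
        * hlMax d f x := by
  let c : ℕ → ℝ := fun k => N ^ d * (2 ^ (d + 1) * ((2 ^ k) ^ (d + 1))⁻¹)
  have hpt : ∀ z, ENNReal.ofReal (N ^ d * ((1 + N * ‖x - z‖) ^ (d + 1))⁻¹) * (‖f z‖₊ : ℝ≥0∞) ≤
      ∑' k : ℕ, ENNReal.ofReal (c k) *
        (ball x (2 ^ k / N)).indicator (fun z => (‖f z‖₊ : ℝ≥0∞)) z := by
    intro z
    obtain ⟨k, hk1, hk2⟩ := lf_exists_dyadic (u := N * ‖x - z‖) (by positivity) d
    refine le_trans ?_ (ENNReal.le_tsum k)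
    have hz : z ∈ ball x (2 ^ k / N) := by
      rw [mem_ball, dist_comm, dist_eq_norm, lt_div_iff₀ hN]
      linarith
    rw [indicator_of_mem hz]
    gcongr
    exact mul_le_mul_of_nonneg_left hk2 (by positivity)
  calc _ ≤ _ := lintegral_mono hpt
    _ = ∑' k : ℕ, ∫⁻ z, ENNReal.ofReal (c k) *
        (ball x (2 ^ k / N)).indicator (fun z => (‖f z‖₊ : ℝ≥0∞)) z := by
      apply lintegral_tsum
      intro k
      exact (hf.nnnorm.aemeasurable.coe_nnreal_ennreal.indicator measurableSet_ball).const_mul _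
    _ = ∑' k : ℕ, ENNReal.ofReal (c k) * ∫⁻ z in ball x (2 ^ k / N), (‖f z‖₊ : ℝ≥0∞) := by
      congr 1
      ext k
      rw [lintegral_const_mul' _ _ ENNReal.ofReal_ne_top, lintegral_indicator measurableSet_ball]
    _ ≤ ∑' k : ℕ, ENNReal.ofReal (c k) * (ENNReal.ofReal ((2 ^ k / N) ^ d) *
        volume (ball (0 : EuclideanSpace ℝ (Fin d)) 1) * hlMax d f x) := by
      gcongr with k
      exact lf_ball_le d f x (by positivity)
    _ = ∑' k : ℕ, ENNReal.ofReal (2 ^ (d + 1) * (1 / 2) ^ k) *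
        (volume (ball (0 : EuclideanSpace ℝ (Fin d)) 1) * hlMax d f x) := by
      congr 1
      ext k
      rw [← mul_assoc, ← mul_assoc, ← ENNReal.ofReal_mul (by positivity), mul_assoc]
      congr 2
      simp only [c]
      rw [div_pow, div_pow, pow_succ ((2:ℝ) ^ k) d]
      field_simp
      simp
    _ = _ := by
      rw [ENNReal.tsum_mul_right, ← ENNReal.ofReal_tsum_of_nonneg (fun k => by positivity)
        (summable_geometric_two.mul_left _), tsum_mul_left, tsum_geometric_two, mul_assoc]

lemma lf_main_bound (d : ℕ) {χ : ℝ → ℝ} (hχsm : ContDiff ℝ (⊤ : ℕ∞) χ)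
    (hχsupp : Function.support χ ⊆ Ioo (1 - 1/100 : ℝ) (2 + 1/100))
    (hχsum : ∀ s : ℝ, 0 < s → HasSum (fun j : ℤ => χ (s / 2 ^ j)) 1) (hd : 2 ≤ d) :
    ∃ C : ℝ≥0, 0 < C ∧ ∀ (n : ℕ) (f : EuclideanSpace ℝ (Fin d) → ℂ)
      (x w : EuclideanSpace ℝ (Fin d)), (2:ℝ) ^ n * ‖x - w‖ ≤ 2 →
      (‖projLT d χ n f w‖₊ : ℝ≥0∞) ≤ C * hlMax d f x := by
  obtain ⟨A, hA, hK⟩ := lf_kernel_bound d hχsm hχsupp hχsum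
  have hVt : volume (ball (0 : EuclideanSpace ℝ (Fin d)) 1) ≠ ⊤ := measure_ball_lt_top.ne
  have hV0 : volume (ball (0 : EuclideanSpace ℝ (Fin d)) 1) ≠ 0 :=
    (measure_ball_pos volume _ one_pos).ne'
  set D : ℝ≥0∞ := ENNReal.ofReal (A * 3 ^ (d + 1)) * (ENNReal.ofReal (2 ^ (d + 1) * 2) *
    volume (ball (0 : EuclideanSpace ℝ (Fin d)) 1)) with hD
  have hDt : D ≠ ⊤ := by
    rw [hD]
    exact ENNReal.mul_ne_top ENNReal.ofReal_ne_top (ENNReal.mul_ne_top ENNReal.ofReal_ne_top hVt)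
  have hD0 : D ≠ 0 := by
    rw [hD]
    refine mul_ne_zero ?_ (mul_ne_zero ?_ hV0)
    · exact (ENNReal.ofReal_pos.2 (by positivity)).ne'
    · exact (ENNReal.ofReal_pos.2 (by positivity)).ne'
  refine ⟨D.toNNReal, ENNReal.toNNReal_pos hD0 hDt, ?_⟩
  intro n f x w hw
  rw [ENNReal.coe_toNNReal hDt]
  by_cases hf : Integrable f
  swap
  · have h0 : 𝓕 f = 0 := by
      ext ξ
      rw [Real.fourier_eq]
      exact integral_undef (fun h => hf ((Real.fourierIntegral_convergent_iff ξ).1 h))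
    have : projLT d χ n f w = 0 := by
      unfold projLT
      rw [h0, Real.fourierInv_eq]
      simp
    rw [this]
    simp
  have hNpos : (0:ℝ) < 2 ^ n := by positivity
  generalize hNdef : (2:ℝ) ^ n = N at *
  have hmi : Integrable (fun ξ => lfMul d χ (N⁻¹ • ξ)) := by
    have h1 : Integrable (lfMul d χ) :=
      (lfMul_contDiff d hχsm hχsupp hχsum).continuous.integrable_of_hasCompactSupport
        (lfMul_compact d hχsupp)
    exact h1.comp_smul (inv_ne_zero hNpos.ne')
  have hproj : projLT d χ n f w = ∫ z, f z * 𝓕⁻ (fun ξ => lfMul d χ (N⁻¹ • ξ)) (w - z) := by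
    rw [← lf_proj_eq d hmi hf w]
    unfold projLT
    rw [Real.fourierInv_eq, Real.fourierInv_eq]
    apply integral_congr_ae
    have : Nontrivial (EuclideanSpace ℝ (Fin d)) := by
      have : Nonempty (Fin d) := ⟨⟨0, by omega⟩⟩
      infer_instance
    have hne : ∀ᵐ ξ : EuclideanSpace ℝ (Fin d), ξ ≠ 0 := by
      simp [ae_iff]
    filter_upwards [hne] with ξ hξ
    congr 2
    unfold lfMul
    rw [lf_tsum hχsupp hχsum n (norm_pos_iff.2 hξ)]
    congr 2
    rw [norm_smul, norm_inv, Real.norm_of_nonneg hNpos.le, zpow_natCast, hNdef]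
    field_simp
  rw [hproj]
  calc (‖∫ z, f z * 𝓕⁻ (fun ξ => lfMul d χ (N⁻¹ • ξ)) (w - z)‖₊ : ℝ≥0∞)
      ≤ ∫⁻ z, (‖f z * 𝓕⁻ (fun ξ => lfMul d χ (N⁻¹ • ξ)) (w - z)‖₊ : ℝ≥0∞) :=
        enorm_integral_le_lintegral_enorm _
    _ ≤ ∫⁻ z, ENNReal.ofReal (A * 3 ^ (d + 1)) *
        (ENNReal.ofReal (N ^ d * ((1 + N * ‖x - z‖) ^ (d + 1))⁻¹) * (‖f z‖₊ : ℝ≥0∞)) := by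
      apply lintegral_mono
      intro z
      dsimp only
      rw [nnnorm_mul, ENNReal.coe_mul, mul_comm, ← mul_assoc,
        ← ENNReal.ofReal_mul (by positivity)]
      gcongr
      rw [← enorm_eq_nnnorm, ← ofReal_norm]
      apply ENNReal.ofReal_le_ofReal
      rw [lf_kernel_scale d χ hNpos, norm_mul, Complex.norm_real,
        Real.norm_of_nonneg (by positivity)]
      have h1 := hK (N • (w - z))
      rw [norm_smul, Real.norm_of_nonneg hNpos.le] at h1
      have h2 : ‖x - z‖ ≤ ‖x - w‖ + ‖w - z‖ := norm_sub_le_norm_sub_add_norm_sub x w z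
      have h3 : 1 + N * ‖x - z‖ ≤ 3 * (1 + N * ‖w - z‖) := by
        have : N * ‖x - z‖ ≤ N * (‖x - w‖ + ‖w - z‖) := by gcongr
        have : 0 ≤ N * ‖w - z‖ := by positivity
        nlinarith
      have h4 : (1 + N * ‖x - z‖) ^ (d + 1) ≤ 3 ^ (d + 1) * (1 + N * ‖w - z‖) ^ (d + 1) := by
        rw [← mul_pow]; gcongr
      have h5 : ‖𝓕⁻ (lfMul d χ) (N • (w - z))‖ ≤
          A * 3 ^ (d + 1) * ((1 + N * ‖x - z‖) ^ (d + 1))⁻¹ := by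
        rw [← div_eq_mul_inv, le_div_iff₀ (by positivity)]
        calc _ ≤ ‖𝓕⁻ (lfMul d χ) (N • (w - z))‖ *
              (3 ^ (d + 1) * (1 + N * ‖w - z‖) ^ (d + 1)) := by gcongr
          _ = 3 ^ (d + 1) * ((1 + N * ‖w - z‖) ^ (d + 1) *
              ‖𝓕⁻ (lfMul d χ) (N • (w - z))‖) := by ring
          _ ≤ 3 ^ (d + 1) * A := by gcongr
          _ = _ := by ring
      calc _ ≤ N ^ d * (A * 3 ^ (d + 1) * ((1 + N * ‖x - z‖) ^ (d + 1))⁻¹) := by gcongr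
        _ = _ := by ring
    _ = ENNReal.ofReal (A * 3 ^ (d + 1)) * ∫⁻ z,
        (ENNReal.ofReal (N ^ d * ((1 + N * ‖x - z‖) ^ (d + 1))⁻¹) * (‖f z‖₊ : ℝ≥0∞)) :=
      lintegral_const_mul' _ _ ENNReal.ofReal_ne_top
    _ ≤ ENNReal.ofReal (A * 3 ^ (d + 1)) * _ :=
      mul_le_mul_right (lf_dyadic d hf.aestronglyMeasurable x hNpos) _
    _ = _ := by rw [hD]; ring

/-- low-frequency spherical averages at scale `2^{-n}` are controlled by the
Hardy–Littlewood maximal function, uniformly in `n`. -/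
theorem low_freq_avg_le_hlMax (d : ℕ) (hd : 2 ≤ d)
    (χ : ℝ → ℝ) (hχsm : ContDiff ℝ (⊤ : ℕ∞) χ)
    (hχsupp : Function.support χ ⊆ Ioo (1 - 1/100 : ℝ) (2 + 1/100))
    (hχsum : ∀ s : ℝ, 0 < s → HasSum (fun j : ℤ => χ (s / 2 ^ j)) 1) :
    ∃ C : ℝ≥0, 0 < C ∧ ∀ (n : ℕ) (f : EuclideanSpace ℝ (Fin d) → ℂ)
      (x : EuclideanSpace ℝ (Fin d)),
      (⨆ (t : ℝ) (_ : t ∈ Icc ((2 : ℝ) ^ (-(n : ℤ))) ((2 : ℝ) ^ (-(n : ℤ) + 1))),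
          (‖sphAvg d (projLT d χ n f) t x‖₊ : ℝ≥0∞)) ≤
        C * hlMax d f x := by
  obtain ⟨C, hC, h⟩ := lf_main_bound d hχsm hχsupp hχsum hd
  refine ⟨C, hC, ?_⟩
  intro n f x
  refine iSup₂_le ?_
  intro t ht
  by_cases htop : (C : ℝ≥0∞) * hlMax d f x = ⊤
  · rw [htop]
    exact le_top
  have ht0 : 0 < t := lt_of_lt_of_le (by positivity) ht.1
  have hb : ∀ y : Metric.sphere (0 : EuclideanSpace ℝ (Fin d)) 1,
      ‖projLT d χ n f (x - t • (y : EuclideanSpace ℝ (Fin d)))‖ ≤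
        ((C : ℝ≥0∞) * hlMax d f x).toReal := by
    intro y
    have hy : ‖(y : EuclideanSpace ℝ (Fin d))‖ = 1 := by simp
    have h1 := h n f x (x - t • (y : EuclideanSpace ℝ (Fin d))) (by
      rw [sub_sub_cancel, norm_smul, hy, Real.norm_of_nonneg ht0.le, mul_one]
      calc (2:ℝ) ^ n * t ≤ 2 ^ n * (2 : ℝ) ^ (-(n : ℤ) + 1) := by gcongr; exact ht.2
        _ = 2 := by
          rw [zpow_add₀ (by norm_num), zpow_neg, zpow_natCast]
          field_simp)
    have h2 := ENNReal.toReal_mono htop h1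
    simpa using h2
  rw [← ENNReal.ofReal_toReal htop, ← enorm_eq_nnnorm, ← ofReal_norm]
  apply ENNReal.ofReal_le_ofReal
  unfold sphAvg
  have : IsFiniteMeasure (sphereMeasure d) := by
    unfold sphereMeasure
    infer_instance
  rw [average_eq, norm_smul]
  have h3 := norm_integral_le_of_norm_le_const (μ := sphereMeasure d)
    (Filter.Eventually.of_forall hb)
  rcases eq_or_ne ((sphereMeasure d).real univ) 0 with h0 | h0
  · rw [h0]
    simp only [inv_zero, norm_zero, zero_mul]
    exact ENNReal.toReal_nonneg
  · have hp : 0 < (sphereMeasure d).real univ := lt_of_le_of_ne measureReal_nonneg h0.symm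
    rw [norm_inv, Real.norm_of_nonneg hp.le, inv_mul_le_iff₀ hp]
    linarith

end
end

section
/- Let d ≥ 2 and d/(d−1) < p < ∞. Then there exist δ = δ(d,p) > 0 and a constant C such that for all integers j, k ≥ 0 with j ≤ k and all f, ‖χ_{−k}(|·|) M_j f‖_{L^p(|x|^{1−d})} ≤ C 2^{−δ(k−j)} ‖P_j f‖_{L^p(ℝ^d)}. -/
open MeasureTheory Metric Complex Set Pointwise
open scoped FourierTransform ENNReal NNReal

noncomputable section

/-- Jensen / Hölder for lower Lebesgue integrals. -/
lemma aux_jensen {α : Type*} [MeasurableSpace α] (μ : Measure α) {p : ℝ} (hp : 1 < p)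
    {h : α → ℝ≥0∞} (hh : AEMeasurable h μ) :
    (∫⁻ a, h a ∂μ) ^ p ≤ μ univ ^ (p - 1) * ∫⁻ a, h a ^ p ∂μ := by
  have hpq := Real.HolderConjugate.conjExponent hp
  have hp0 : 0 < p := by linarith
  have := ENNReal.lintegral_mul_le_Lp_mul_Lq μ hpq hh (aemeasurable_const (b := (1 : ℝ≥0∞)))
  simp only [Pi.mul_apply, mul_one, ENNReal.one_rpow, lintegral_one] at this
  calc (∫⁻ a, h a ∂μ) ^ p
      ≤ ((∫⁻ a, h a ^ p ∂μ) ^ (1 / p) * μ univ ^ (1 / p.conjExponent)) ^ p := by gcongr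
    _ = μ univ ^ (p - 1) * ∫⁻ a, h a ^ p ∂μ := by
      rw [ENNReal.mul_rpow_of_nonneg _ _ hp0.le, ← ENNReal.rpow_mul, ← ENNReal.rpow_mul, mul_comm,
        one_div_mul_cancel hp0.ne', ENNReal.rpow_one]
      congr 2
      rw [Real.conjExponent]
      field_simp

/-- The decaying kernel. -/
def aux_K (d : ℕ) (v : EuclideanSpace ℝ (Fin d)) : ℝ≥0∞ :=
  ENNReal.ofReal ((1 + ‖v‖) ^ (-((d : ℝ) + 1)))

lemma aux_K_meas (d : ℕ) : Measurable (aux_K d) := by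
  unfold aux_K
  fun_prop

lemma aux_K_fin (d : ℕ) : ∫⁻ v, aux_K d v < ∞ := by
  unfold aux_K
  exact finite_integral_one_add_norm (by simp)

lemma aux_K_compare (d : ℕ) {u v : EuclideanSpace ℝ (Fin d)} (h : ‖v‖ ≤ ‖u‖ + 1) :
    aux_K d u ≤ 2 ^ (d + 1) * aux_K d v := by
  unfold aux_K
  have e : (2 : ℝ≥0∞) ^ (d + 1) = ENNReal.ofReal (2 ^ (d + 1)) := by
    rw [ENNReal.ofReal_pow (by norm_num)]; norm_num
  rw [e, ← ENNReal.ofReal_mul (by positivity)]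
  apply ENNReal.ofReal_le_ofReal
  have hu : 0 < 1 + ‖u‖ := by positivity
  have hv : 0 < 1 + ‖v‖ := by positivity
  have e1 : -((d : ℝ) + 1) = -(((d + 1 : ℕ) : ℝ)) := by push_cast; ring
  rw [e1, Real.rpow_neg hu.le, Real.rpow_neg hv.le, Real.rpow_natCast, Real.rpow_natCast,
    ← div_eq_mul_inv, ← one_div, div_le_div_iff₀ (by positivity) (by positivity), one_mul,
    ← mul_pow]
  apply pow_le_pow_left₀ hv.le
  nlinarith [norm_nonneg u]

lemma aux_scale (d : ℕ) {r : ℝ} (hr : 0 < r) {F : EuclideanSpace ℝ (Fin d) → ℝ≥0∞}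
    (hF : Measurable F) (u : EuclideanSpace ℝ (Fin d)) :
    ∫⁻ v, F (r⁻¹ • (u - v)) = ENNReal.ofReal (r ^ d) * ∫⁻ v, F v := by
  rw [lintegral_sub_left_eq_self (fun v => F (r⁻¹ • v)) u]
  have := Measure.map_addHaar_smul (volume : Measure (EuclideanSpace ℝ (Fin d)))
    (inv_ne_zero hr.ne')
  rw [← lintegral_map (f := F) (g := fun v => r⁻¹ • v) hF (by fun_prop), this,
    lintegral_smul_measure]
  simp [abs_of_pos hr]

lemma aux_sphere (d : ℕ) (hd : 2 ≤ d) {t r : ℝ} (ht : 1 < t) (hr : 0 < r)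
    (z : EuclideanSpace ℝ (Fin d)) :
    ENNReal.ofReal r * ∫⁻ y, aux_K d (r⁻¹ • (z - t • (y : EuclideanSpace ℝ (Fin d))))
      ∂(sphereMeasure d) ≤ 2 ^ (d + 1) * (ENNReal.ofReal (r ^ d) * ∫⁻ v, aux_K d v) := by
  have hKm := aux_K_meas d
  set G : EuclideanSpace ℝ (Fin d) → ℝ≥0∞ := fun v => 2 ^ (d + 1) * aux_K d (r⁻¹ • (z - v)) with hG
  have hGm : Measurable G := by
    rw [hG]; fun_prop
  have step1 : ∀ y : sphere (0 : EuclideanSpace ℝ (Fin d)) 1,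
      ENNReal.ofReal r * aux_K d (r⁻¹ • (z - t • (y : EuclideanSpace ℝ (Fin d)))) ≤
      ∫⁻ s : Ioi (0 : ℝ), G (s.1 • (y : EuclideanSpace ℝ (Fin d)))
        ∂(Measure.volumeIoiPow (d - 1)) := by
    intro y
    have hy : ‖(y : EuclideanSpace ℝ (Fin d))‖ = 1 := by simp
    rw [Measure.volumeIoiPow, lintegral_withDensity_eq_lintegral_mul _ (by fun_prop)
      (by fun_prop)]
    simp only [Pi.mul_apply]
    rw [lintegral_subtype_comap measurableSet_Ioi (fun s : ℝ => ENNReal.ofReal (s ^ (d - 1)) *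
      G (s • (y : EuclideanSpace ℝ (Fin d))))]
    have hsub : Ioo t (t + r) ⊆ Ioi 0 := fun s hs => lt_trans (by linarith) hs.1
    refine le_trans ?_ (lintegral_mono_set hsub)
    have : ENNReal.ofReal r = volume (Ioo t (t + r)) := by simp
    rw [this, mul_comm, ← setLIntegral_const]
    refine setLIntegral_mono' measurableSet_Ioo fun s hs => ?_
    have h1 : (1 : ℝ≥0∞) ≤ ENNReal.ofReal (s ^ (d - 1)) := by
      rw [ENNReal.one_le_ofReal]
      exact one_le_pow₀ (by linarith [hs.1])
    refine le_trans ?_ (mul_le_mul_left h1 _)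
    rw [one_mul]
    apply aux_K_compare
    have e : r⁻¹ • (z - s • (y : EuclideanSpace ℝ (Fin d))) =
      r⁻¹ • (z - t • (y : EuclideanSpace ℝ (Fin d))) -
        (r⁻¹ * (s - t)) • (y : EuclideanSpace ℝ (Fin d)) := by
      module
    rw [e]
    refine (norm_sub_le _ _).trans ?_
    gcongr
    rw [norm_smul, hy, mul_one, Real.norm_eq_abs, abs_of_nonneg
      (mul_nonneg (by positivity) (by linarith [hs.1])), inv_mul_le_iff₀ hr]
    linarith [hs.2]
  have hpol : ∫⁻ y : sphere (0 : EuclideanSpace ℝ (Fin d)) 1,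
      ∫⁻ s : Ioi (0 : ℝ), G (s.1 • (y : EuclideanSpace ℝ (Fin d)))
        ∂(Measure.volumeIoiPow (d - 1)) ∂(sphereMeasure d) ≤ ∫⁻ v, G v := by
    have mp := (volume : Measure (EuclideanSpace ℝ (Fin d))).measurePreserving_homeomorphUnitSphereProd
    rw [finrank_euclideanSpace_fin] at mp
    unfold sphereMeasure
    have hm : Measurable (fun q : sphere (0 : EuclideanSpace ℝ (Fin d)) 1 × Ioi (0 : ℝ) =>
      G (q.2.1 • (q.1 : EuclideanSpace ℝ (Fin d)))) := hGm.comp (by fun_prop)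
    rw [← lintegral_prod (fun q : sphere (0 : EuclideanSpace ℝ (Fin d)) 1 × Ioi (0 : ℝ) =>
      G (q.2.1 • (q.1 : EuclideanSpace ℝ (Fin d)))) hm.aemeasurable]
    rw [← mp.lintegral_comp hm]
    have e : ∀ a : ({0}ᶜ : Set (EuclideanSpace ℝ (Fin d))),
      ((homeomorphUnitSphereProd (EuclideanSpace ℝ (Fin d)) a).2.1 •
        ((homeomorphUnitSphereProd (EuclideanSpace ℝ (Fin d)) a).1 : EuclideanSpace ℝ (Fin d)))
        = a := by
      intro a
      have : ‖(a : EuclideanSpace ℝ (Fin d))‖ ≠ 0 := by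
        rw [norm_ne_zero_iff]
        exact a.2
      simp [smul_smul, this]
    simp only [e]
    rw [lintegral_subtype_comap (measurableSet_singleton _).compl G]
    exact setLIntegral_le_lintegral _ _
  rw [← lintegral_const_mul' _ _ ENNReal.ofReal_ne_top]
  calc _ ≤ _ := lintegral_mono step1
    _ ≤ _ := hpol
    _ = _ := by
      rw [hG, lintegral_const_mul _ (by fun_prop), aux_scale d hr hKm]

/-- Reproducing formula, giving a pointwise bound. -/
lemma aux_repro (d : ℕ) : ∃ C : ℝ≥0, ∀ (r : ℝ), 0 < r →
    ∀ g : EuclideanSpace ℝ (Fin d) → ℂ, Integrable g → (∀ ξ, 3 < ‖r • ξ‖ → g ξ = 0) →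
    ∀ x, ‖(𝓕⁻ g) x‖ₑ ≤ C * ∫⁻ v, aux_K d v * ‖(𝓕⁻ g) (x - r • v)‖ₑ := by
  let b : ContDiffBump (0 : EuclideanSpace ℝ (Fin d)) := ⟨3, 4, by norm_num, by norm_num⟩
  have hb1 : HasCompactSupport (fun x => ((b x : ℝ) : ℂ)) :=
    b.hasCompactSupport.comp_left (g := fun t : ℝ => (t : ℂ)) (by simp)
  have hb2 : ContDiff ℝ (⊤ : ℕ∞) (fun x => ((b x : ℝ) : ℂ)) :=
    Complex.ofRealCLM.contDiff.comp b.contDiff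
  let ψ : SchwartzMap (EuclideanSpace ℝ (Fin d)) ℂ := hb1.toSchwartzMap hb2
  let Φ : SchwartzMap (EuclideanSpace ℝ (Fin d)) ℂ := 𝓕⁻ ψ
  have hΦ : 𝓕 (Φ : EuclideanSpace ℝ (Fin d) → ℂ) = fun x => ((b x : ℝ) : ℂ) := by
    rw [← SchwartzMap.fourier_coe]
    have : 𝓕 Φ = ψ := FourierTransform.fourier_fourierInv_eq ψ
    rw [this]; rfl
  have hdec := fun x => SchwartzMap.one_add_le_sup_seminorm_apply (𝕜 := ℝ) (m := (d + 1, 0))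
    (k := d + 1) (n := 0) le_rfl le_rfl Φ x
  simp only [norm_iteratedFDeriv_zero] at hdec
  set S : ℝ := 2 ^ (d + 1) * (Finset.Iic (d + 1, 0)).sup
    (fun m => SchwartzMap.seminorm ℝ m.1 m.2) Φ with hS
  have hdec2 : ∀ v, ‖Φ v‖ₑ ≤ (S.toNNReal : ℝ≥0∞) * aux_K d v := by
    intro v
    unfold aux_K
    have hv : 0 < 1 + ‖v‖ := by positivity
    have hS0 : 0 ≤ S := le_trans (by positivity) (hdec 0)
    have e1 : -((d : ℝ) + 1) = -(((d + 1 : ℕ) : ℝ)) := by push_cast; ring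
    rw [← ofReal_norm]
    change _ ≤ ENNReal.ofReal S * _
    rw [← ENNReal.ofReal_mul hS0, e1, Real.rpow_neg hv.le, Real.rpow_natCast]
    apply ENNReal.ofReal_le_ofReal
    rw [← div_eq_mul_inv, le_div_iff₀ (by positivity), mul_comm]
    exact hdec v
  refine ⟨S.toNNReal, fun r hr g hg hsupp x => ?_⟩
  have hrep : (𝓕⁻ g) x = ∫ v, Φ v * (𝓕⁻ g) (x - r • v) := by
    have hbg : ∀ ξ, g ξ = g ξ * 𝓕 (Φ : EuclideanSpace ℝ (Fin d) → ℂ) (r • ξ) := by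
      intro ξ
      rw [hΦ]
      by_cases h : 3 < ‖r • ξ‖
      · simp [hsupp ξ h]
      · have : b (r • ξ) = 1 := b.one_of_mem_closedBall (by simpa using not_lt.mp h)
        simp [this]
    have hint : Integrable (fun q : EuclideanSpace ℝ (Fin d) × EuclideanSpace ℝ (Fin d) =>
        ((Real.fourierChar (inner ℝ q.1 (x - r • q.2)) : Circle) : ℂ) * (g q.1 * Φ q.2))
        (volume.prod volume) := by
      have h0 : Integrable (fun q : EuclideanSpace ℝ (Fin d) × EuclideanSpace ℝ (Fin d) =>
        g q.1 * Φ q.2) (volume.prod volume) := hg.mul_prod Φ.integrable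
      refine h0.bdd_mul (c := 1) ?_ ?_
      · apply Continuous.aestronglyMeasurable
        have := Real.continuous_fourierChar
        fun_prop
      · filter_upwards with q
        exact (Circle.norm_coe _).le
    calc (𝓕⁻ g) x = ∫ ξ, ∫ v, ((Real.fourierChar (inner ℝ ξ (x - r • v)) : Circle) : ℂ) *
          (g ξ * Φ v) := by
          rw [Real.fourierInv_eq]
          congr 1; ext ξ
          conv_lhs => rw [hbg ξ]
          rw [Real.fourier_eq, Circle.smul_def, smul_eq_mul, ← integral_const_mul,
            ← integral_const_mul]
          congr 1; ext v
          rw [Circle.smul_def, smul_eq_mul, inner_sub_right, sub_eq_add_neg,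
            AddChar.map_add_eq_mul, ← inner_neg_right, ← smul_neg, inner_smul_right,
            inner_neg_right, inner_smul_right, real_inner_comm ξ v, mul_neg, Circle.coe_mul]
          ring
      _ = ∫ v, ∫ ξ, ((Real.fourierChar (inner ℝ ξ (x - r • v)) : Circle) : ℂ) *
          (g ξ * Φ v) := integral_integral_swap hint
      _ = _ := by
          congr 1; ext v
          rw [Real.fourierInv_eq, ← integral_const_mul]
          congr 1; ext ξ
          rw [Circle.smul_def, smul_eq_mul]
          ring
  calc ‖(𝓕⁻ g) x‖ₑ = ‖∫ v, Φ v * (𝓕⁻ g) (x - r • v)‖ₑ := by rw [← hrep]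
    _ ≤ ∫⁻ v, ‖Φ v * (𝓕⁻ g) (x - r • v)‖ₑ := enorm_integral_le_lintegral_enorm _
    _ ≤ ∫⁻ v, (S.toNNReal : ℝ≥0∞) * (aux_K d v * ‖(𝓕⁻ g) (x - r • v)‖ₑ) := by
        refine lintegral_mono fun v => ?_
        rw [enorm_mul, ← mul_assoc]
        exact mul_le_mul_left (hdec2 v) _
    _ = _ := by rw [lintegral_const_mul' _ _ ENNReal.coe_ne_top]

lemma aux_cont (d : ℕ) {g : EuclideanSpace ℝ (Fin d) → ℂ} (hg : Integrable g) :
    Continuous (𝓕 g) :=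
  VectorFourier.fourierIntegral_continuous Real.continuous_fourierChar
    (innerSL ℝ).continuous₂ hg

lemma aux_cont_inv (d : ℕ) {g : EuclideanSpace ℝ (Fin d) → ℂ} (hg : Integrable g) :
    Continuous (𝓕⁻ g) := by
  have : 𝓕⁻ g = fun x => 𝓕 g (-x) := by
    ext x; exact Real.fourierInv_eq_fourier_neg g x
  rw [this]
  exact (aux_cont d hg).comp continuous_neg

lemma aux_max (d : ℕ) (hd : 2 ≤ d) {p : ℝ} (hp : 1 < p) : ∃ C : ℝ≥0∞, C ≠ ⊤ ∧
    ∀ r : ℝ, 0 < r →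
    ∀ g : EuclideanSpace ℝ (Fin d) → ℂ, Integrable g → (∀ ξ, 3 < ‖r • ξ‖ → g ξ = 0) →
    ∀ t : ℝ, 1 < t → ∀ x, ENNReal.ofReal r * ‖sphAvg d (𝓕⁻ g) t x‖ₑ ^ p ≤
      C * ∫⁻ w, ‖(𝓕⁻ g) w‖ₑ ^ p := by
  obtain ⟨C₁, hC₁⟩ := aux_repro d
  have hp0 : 0 < p := by linarith
  set I : ℝ≥0∞ := ∫⁻ v, aux_K d v with hI
  have hIfin : I < ⊤ := aux_K_fin d
  set c : ℝ≥0∞ := sphereMeasure d univ with hc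
  have : Nonempty (Fin d) := ⟨⟨0, by omega⟩⟩
  have hc0 : c ≠ 0 := by
    rw [hc, sphereMeasure, Measure.toSphere_apply_univ]
    have : (volume (ball (0 : EuclideanSpace ℝ (Fin d)) 1)) ≠ 0 :=
      (measure_ball_pos _ _ one_pos).ne'
    simp only [finrank_euclideanSpace_fin]
    refine mul_ne_zero ?_ this
    simp; omega
  have : IsFiniteMeasure (sphereMeasure d) := by unfold sphereMeasure; infer_instance
  refine ⟨c⁻¹ * ((C₁ : ℝ≥0∞) ^ p * I ^ (p - 1)) * (2 ^ (d + 1) * I), ?_, ?_⟩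
  · refine ENNReal.mul_ne_top (ENNReal.mul_ne_top (ENNReal.inv_ne_top.mpr hc0)
      (ENNReal.mul_ne_top ?_ ?_)) (ENNReal.mul_ne_top ?_ hIfin.ne)
    · exact ENNReal.rpow_ne_top_of_nonneg hp0.le ENNReal.coe_ne_top
    · exact ENNReal.rpow_ne_top_of_nonneg (by linarith) hIfin.ne
    · exact ENNReal.pow_ne_top (by norm_num)
  intro r hr g hg hsupp t ht x
  have hcont := aux_cont_inv d hg
  have hKm := aux_K_meas d
  set F : EuclideanSpace ℝ (Fin d) → ℝ≥0∞ := fun w => ‖(𝓕⁻ g) w‖ₑ with hF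
  have hFm : Measurable F := hcont.measurable.enorm
  -- pointwise bound
  have hpt : ∀ u, F u ^ p ≤ (C₁ : ℝ≥0∞) ^ p * I ^ (p - 1) *
      ∫⁻ v, aux_K d v * F (u - r • v) ^ p := by
    intro u
    have hm1 : Measurable fun v => F (u - r • v) := by fun_prop
    have hm2 : Measurable fun v => F (u - r • v) ^ p := by fun_prop
    have hJ := aux_jensen (volume.withDensity (aux_K d)) hp hm1.aemeasurable
    rw [lintegral_withDensity_eq_lintegral_mul _ hKm hm1,
      lintegral_withDensity_eq_lintegral_mul _ hKm hm2, withDensity_apply _ MeasurableSet.univ,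
      setLIntegral_univ] at hJ
    simp only [Pi.mul_apply] at hJ
    calc F u ^ p ≤ (C₁ * ∫⁻ v, aux_K d v * F (u - r • v)) ^ p :=
          ENNReal.rpow_le_rpow (hC₁ r hr g hg hsupp u) hp0.le
      _ = (C₁ : ℝ≥0∞) ^ p * (∫⁻ v, aux_K d v * F (u - r • v)) ^ p :=
          ENNReal.mul_rpow_of_nonneg _ _ hp0.le
      _ ≤ (C₁ : ℝ≥0∞) ^ p * (I ^ (p - 1) * ∫⁻ v, aux_K d v * F (u - r • v) ^ p) := by
          gcongr
      _ = _ := by ring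
  -- average bound
  have havg : ‖sphAvg d (𝓕⁻ g) t x‖ₑ ^ p ≤
      c⁻¹ * ∫⁻ y, F (x - t • (y : EuclideanSpace ℝ (Fin d))) ^ p ∂(sphereMeasure d) := by
    have hm1 : Measurable fun y : sphere (0 : EuclideanSpace ℝ (Fin d)) 1 =>
      F (x - t • (y : EuclideanSpace ℝ (Fin d))) := hFm.comp (by fun_prop)
    have hJ := aux_jensen (c⁻¹ • sphereMeasure d) hp hm1.aemeasurable
    calc ‖sphAvg d (𝓕⁻ g) t x‖ₑ ^ p
        ≤ (∫⁻ y, F (x - t • (y : EuclideanSpace ℝ (Fin d))) ∂(c⁻¹ • sphereMeasure d)) ^ p := by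
          apply ENNReal.rpow_le_rpow _ hp0.le
          unfold sphAvg average
          exact enorm_integral_le_lintegral_enorm _
      _ ≤ _ := hJ
      _ ≤ 1 * (c⁻¹ * ∫⁻ y, F (x - t • (y : EuclideanSpace ℝ (Fin d))) ^ p
            ∂(sphereMeasure d)) := by
          rw [lintegral_smul_measure, smul_eq_mul]
          gcongr
          rw [Measure.smul_apply, smul_eq_mul, ← hc]
          exact ENNReal.rpow_le_one (ENNReal.inv_mul_le_one _) (by linarith)
      _ = _ := one_mul _
  -- the double integral
  have hr0 : ENNReal.ofReal (r ^ d) ≠ 0 := by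
    simpa using pow_pos hr d
  have hdbl : ENNReal.ofReal r * ∫⁻ y, ∫⁻ v, aux_K d v *
      F (x - t • ((y : sphere (0 : EuclideanSpace ℝ (Fin d)) 1) : EuclideanSpace ℝ (Fin d))
        - r • v) ^ p ∂volume ∂(sphereMeasure d) ≤ 2 ^ (d + 1) * I * ∫⁻ w, F w ^ p := by
    rw [← ENNReal.mul_le_mul_iff_right hr0 ENNReal.ofReal_ne_top]
    have e1 : ∀ u : EuclideanSpace ℝ (Fin d),
        ENNReal.ofReal (r ^ d) * ∫⁻ v, aux_K d v * F (u - r • v) ^ p =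
        ∫⁻ w, aux_K d (r⁻¹ • (u - w)) * F w ^ p := by
      intro u
      rw [← aux_scale d hr (F := fun v => aux_K d v * F (u - r • v) ^ p) (by fun_prop) u]
      simp [smul_smul, hr.ne']
    calc ENNReal.ofReal (r ^ d) * (ENNReal.ofReal r * ∫⁻ y, ∫⁻ v, aux_K d v *
          F (x - t • ((y : sphere (0 : EuclideanSpace ℝ (Fin d)) 1) : EuclideanSpace ℝ (Fin d))
          - r • v) ^ p ∂volume ∂(sphereMeasure d))
        = ENNReal.ofReal r * ∫⁻ y, ∫⁻ w, aux_K d (r⁻¹ • (x - t •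
          ((y : sphere (0 : EuclideanSpace ℝ (Fin d)) 1) : EuclideanSpace ℝ (Fin d)) - w)) *
            F w ^ p ∂volume ∂(sphereMeasure d) := by
          rw [mul_left_comm, ← lintegral_const_mul' _ _ ENNReal.ofReal_ne_top]
          simp only [e1]
      _ = ENNReal.ofReal r * ∫⁻ w, ∫⁻ y, aux_K d (r⁻¹ • (x - t •
          ((y : sphere (0 : EuclideanSpace ℝ (Fin d)) 1) : EuclideanSpace ℝ (Fin d)) - w)) *
            F w ^ p ∂(sphereMeasure d) ∂volume := by
          rw [lintegral_lintegral_swap]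
          apply Measurable.aemeasurable
          apply Measurable.mul
          · exact hKm.comp (by fun_prop)
          · exact (hFm.comp measurable_snd).pow_const p
      _ = ∫⁻ w, (ENNReal.ofReal r * ∫⁻ y, aux_K d (r⁻¹ • ((x - w) - t •
          ((y : sphere (0 : EuclideanSpace ℝ (Fin d)) 1) : EuclideanSpace ℝ (Fin d))))
            ∂(sphereMeasure d)) * F w ^ p ∂volume := by
          rw [← lintegral_const_mul' _ _ ENNReal.ofReal_ne_top]
          congr 1; ext w
          have hmy : Measurable fun y : sphere (0 : EuclideanSpace ℝ (Fin d)) 1 =>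
              aux_K d (r⁻¹ • (x - t • (y : EuclideanSpace ℝ (Fin d)) - w)) :=
            hKm.comp (by fun_prop)
          rw [lintegral_mul_const _ hmy, mul_assoc]
          simp only [sub_right_comm]
      _ ≤ ∫⁻ w, (2 ^ (d + 1) * (ENNReal.ofReal (r ^ d) * I)) * F w ^ p ∂volume := by
          refine lintegral_mono fun w => ?_
          exact mul_le_mul_left (aux_sphere d hd ht hr (x - w)) _
      _ = _ := by
          rw [lintegral_const_mul _ (by fun_prop)]
          ring
  set D : ℝ≥0∞ := (C₁ : ℝ≥0∞) ^ p * I ^ (p - 1) with hD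
  have hDfin : D ≠ ⊤ := ENNReal.mul_ne_top
    (ENNReal.rpow_ne_top_of_nonneg hp0.le ENNReal.coe_ne_top)
    (ENNReal.rpow_ne_top_of_nonneg (by linarith) hIfin.ne)
  calc ENNReal.ofReal r * ‖sphAvg d (𝓕⁻ g) t x‖ₑ ^ p
      ≤ ENNReal.ofReal r * (c⁻¹ * ∫⁻ y, D * ∫⁻ v, aux_K d v *
      F (x - t • ((y : sphere (0 : EuclideanSpace ℝ (Fin d)) 1) : EuclideanSpace ℝ (Fin d))
        - r • v) ^ p ∂volume ∂(sphereMeasure d)) := by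
        gcongr
        refine havg.trans ?_
        gcongr
        exact hpt _
    _ = c⁻¹ * D * (ENNReal.ofReal r * ∫⁻ y, ∫⁻ v, aux_K d v *
      F (x - t • ((y : sphere (0 : EuclideanSpace ℝ (Fin d)) 1) : EuclideanSpace ℝ (Fin d))
        - r • v) ^ p ∂volume ∂(sphereMeasure d)) := by
        rw [lintegral_const_mul' _ _ hDfin]
        ring
    _ ≤ c⁻¹ * D * (2 ^ (d + 1) * I * ∫⁻ w, F w ^ p) := by gcongr
    _ = _ := by ring

/-- The weighted measure of the annulus. -/
lemma aux_annulus (d : ℕ) (hd : 2 ≤ d) {p : ℝ} (hp : 1 < p) (χ : ℝ → ℝ) (hχ : Continuous χ)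
    (hχsupp : Function.support χ ⊆ Ioo (1 - 1/100 : ℝ) (2 + 1/100)) :
    ∃ C : ℝ≥0∞, C ≠ ⊤ ∧ ∀ k : ℕ,
      ∫⁻ x : EuclideanSpace ℝ (Fin d), ‖χ ((2 : ℝ) ^ (k : ℤ) * ‖x‖)‖ₑ ^ p * wt d x ≤
        C * ENNReal.ofReal (((2 : ℝ) ^ k)⁻¹) := by
  have hp0 : 0 < p := by linarith
  have hcs : HasCompactSupport χ :=
    HasCompactSupport.intro (isCompact_Icc (a := (1 - 1/100 : ℝ)) (b := 2 + 1/100)) (by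
      intro x hx
      by_contra h
      exact hx (Ioo_subset_Icc_self (hχsupp h)))
  obtain ⟨B, hB⟩ := hcs.exists_bound_of_continuous hχ
  set V : ℝ≥0∞ := volume (ball (0 : EuclideanSpace ℝ (Fin d)) 1) with hV
  have : Nonempty (Fin d) := ⟨⟨0, by omega⟩⟩
  have hVfin : V ≠ ⊤ := measure_ball_lt_top.ne
  refine ⟨ENNReal.ofReal B ^ p * (ENNReal.ofReal (2 ^ (d - 1) * 3 ^ d) * V), ?_, fun k => ?_⟩
  · exact ENNReal.mul_ne_top (ENNReal.rpow_ne_top_of_nonneg hp0.le ENNReal.ofReal_ne_top)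
      (ENNReal.mul_ne_top ENNReal.ofReal_ne_top hVfin)
  have h2k : (0 : ℝ) < 2 ^ k := by positivity
  set W : ℝ≥0∞ := ENNReal.ofReal B ^ p * ENNReal.ofReal ((2 * 2 ^ k) ^ (d - 1)) with hW
  have hbd : ∀ x : EuclideanSpace ℝ (Fin d), ‖χ ((2 : ℝ) ^ (k : ℤ) * ‖x‖)‖ₑ ^ p * wt d x ≤
      (closedBall (0 : EuclideanSpace ℝ (Fin d)) (3 * (2 ^ k)⁻¹)).indicator (fun _ => W) x := by
    intro x
    rw [zpow_natCast]
    by_cases h0 : χ ((2 : ℝ) ^ k * ‖x‖) = 0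
    · simp [h0, hp0]
    have hmem := hχsupp (Function.mem_support.mpr h0)
    have hx : x ∈ closedBall (0 : EuclideanSpace ℝ (Fin d)) (3 * (2 ^ k)⁻¹) := by
      rw [mem_closedBall_zero_iff, ← div_eq_mul_inv, le_div_iff₀ h2k]
      linarith [hmem.2]
    rw [indicator_of_mem hx, hW]
    gcongr
    · rw [← ofReal_norm]
      exact ENNReal.ofReal_le_ofReal (hB _)
    · unfold wt
      apply ENNReal.ofReal_le_ofReal
      have hxl : (2 * 2 ^ k)⁻¹ ≤ ‖x‖ := by
        rw [inv_le_iff_one_le_mul₀ (by positivity)]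
        nlinarith [hmem.1]
      have hdr : (1 : ℝ) - d = -((d - 1 : ℕ) : ℝ) := by
        rw [Nat.cast_sub (by omega)]; push_cast; ring
      calc ‖x‖ ^ ((1 : ℝ) - d) ≤ ((2 * 2 ^ k : ℝ)⁻¹) ^ ((1 : ℝ) - d) := by
            apply Real.rpow_le_rpow_of_nonpos (by positivity) hxl
            rw [hdr]; simp
        _ = _ := by
            rw [hdr, Real.rpow_neg (by positivity), Real.rpow_natCast, inv_pow, inv_inv]
  calc _ ≤ _ := lintegral_mono hbd
    _ = W * (ENNReal.ofReal ((3 * (2 ^ k)⁻¹) ^ d) * V) := by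
        rw [lintegral_indicator_const measurableSet_closedBall,
          Measure.addHaar_closedBall _ _ (by positivity), finrank_euclideanSpace_fin]
    _ = ENNReal.ofReal B ^ p * (ENNReal.ofReal ((2 * 2 ^ k) ^ (d - 1) * (3 * (2 ^ k)⁻¹) ^ d)) * V := by
        rw [hW, ENNReal.ofReal_mul (by positivity)]
        ring
    _ = ENNReal.ofReal B ^ p * (ENNReal.ofReal ((2 ^ (d - 1) * 3 ^ d) * (2 ^ k)⁻¹)) * V := by
        congr 3
        obtain ⟨n, rfl⟩ : ∃ n, d = n + 1 := ⟨d - 1, by omega⟩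
        rw [Nat.add_sub_cancel]
        generalize (2 : ℝ) ^ k = a at *
        rw [mul_pow, mul_pow, pow_succ (a⁻¹), inv_pow]
        field_simp
    _ = _ := by
        rw [ENNReal.ofReal_mul (by positivity)]
        ring

/-- estimate `(jk piece without local)`, case `j ≤ k`. -/
theorem mj_annulus_jk (d : ℕ) (hd : 2 ≤ d) (p : ℝ) (hp : (d : ℝ) / ((d : ℝ) - 1) < p)
    (χ : ℝ → ℝ) (hχsm : ContDiff ℝ (⊤ : ℕ∞) χ)
    (hχsupp : Function.support χ ⊆ Ioo (1 - 1/100 : ℝ) (2 + 1/100))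
    (hχsum : ∀ s : ℝ, 0 < s → HasSum (fun j : ℤ => χ (s / 2 ^ j)) 1) :
    ∃ δ : ℝ, 0 < δ ∧ ∃ C : ℝ≥0, 0 < C ∧
      ∀ j k : ℕ, j ≤ k → ∀ f : EuclideanSpace ℝ (Fin d) → ℂ,
        (∫⁻ x, (‖χ ((2 : ℝ) ^ (k : ℤ) * ‖x‖)‖₊ : ℝ≥0∞) ^ p *
            sphMaxLoc d (proj d χ j f) x ^ p * wt d x) ^ (1/p) ≤
          C * (2 : ℝ≥0∞) ^ (-(δ * ((k : ℝ) - (j : ℝ)))) *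
            (∫⁻ x, (‖proj d χ j f x‖₊ : ℝ≥0∞) ^ p) ^ (1/p) := by
  have hp1 : 1 < p := by
    have hd' : (2 : ℝ) ≤ d := by exact_mod_cast hd
    refine lt_trans ?_ hp
    rw [lt_div_iff₀ (by linarith)]
    linarith
  have hp0 : 0 < p := by linarith
  have hχc : Continuous χ := hχsm.continuous
  obtain ⟨C₁, hC₁, H₁⟩ := aux_max d hd hp1
  obtain ⟨C₂, hC₂, H₂⟩ := aux_annulus d hd hp1 χ hχc hχsupp
  have hCfin : (C₁ * C₂) ^ (1 / p) ≠ ⊤ :=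
    ENNReal.rpow_ne_top_of_nonneg (by positivity) (ENNReal.mul_ne_top hC₁ hC₂)
  refine ⟨1 / p, by positivity, ((C₁ * C₂) ^ (1 / p)).toNNReal + 1, by positivity, ?_⟩
  intro j k _ f
  have h2j : (0 : ℝ) < 2 ^ j := by positivity
  set g : EuclideanSpace ℝ (Fin d) → ℂ := fun ξ => (χ (‖ξ‖ / 2 ^ (j : ℤ)) : ℂ) * 𝓕 f ξ with hg
  have hproj : proj d χ j f = 𝓕⁻ g := rfl
  have hFc : Continuous (𝓕 f) := by
    by_cases hf : Integrable f
    · exact aux_cont d hf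
    · have : 𝓕 f = fun _ => 0 := by
        ext ξ
        rw [Real.fourier_eq]
        apply integral_undef
        rwa [Real.fourierIntegral_convergent_iff]
      rw [this]
      exact continuous_const
  have hsupp : ∀ ξ, 3 < ‖((2 : ℝ) ^ j)⁻¹ • ξ‖ → g ξ = 0 := by
    intro ξ hξ
    rw [norm_smul, norm_inv, Real.norm_of_nonneg h2j.le] at hξ
    have : χ (‖ξ‖ / 2 ^ (j : ℤ)) = 0 := by
      by_contra h
      have := (hχsupp (Function.mem_support.mpr h)).2
      rw [zpow_natCast, div_eq_inv_mul] at this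
      linarith
    simp only [hg, this, Complex.ofReal_zero, zero_mul]
  have hgc : Continuous g := by
    rw [hg]
    fun_prop
  have hgi : Integrable g := by
    apply hgc.integrable_of_hasCompactSupport
    refine HasCompactSupport.intro (isCompact_closedBall (0 : EuclideanSpace ℝ (Fin d))
      (3 * 2 ^ j)) fun ξ hξ => hsupp ξ ?_
    rw [mem_closedBall_zero_iff, not_le] at hξ
    rw [norm_smul, norm_inv, Real.norm_of_nonneg h2j.le, lt_inv_mul_iff₀ h2j]
    linarith
  rw [hproj]
  set N : ℝ≥0∞ := ∫⁻ x, (‖(𝓕⁻ g) x‖₊ : ℝ≥0∞) ^ p with hN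
  have hM : ∀ x, sphMaxLoc d (𝓕⁻ g) x ^ p ≤ ENNReal.ofReal (2 ^ j) * (C₁ * N) := by
    intro x
    rw [← ENNReal.le_rpow_inv_iff hp0]
    unfold sphMaxLoc
    refine iSup₂_le fun t ht => ?_
    rw [ENNReal.le_rpow_inv_iff hp0]
    have := H₁ _ (inv_pos.mpr h2j) g hgi hsupp t ht.1 x
    calc (‖sphAvg d (𝓕⁻ g) t x‖₊ : ℝ≥0∞) ^ p
        = ENNReal.ofReal (2 ^ j) * (ENNReal.ofReal ((2 ^ j)⁻¹) *
            ‖sphAvg d (𝓕⁻ g) t x‖ₑ ^ p) := by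
          rw [← mul_assoc, ← ENNReal.ofReal_mul h2j.le, mul_inv_cancel₀ h2j.ne',
            ENNReal.ofReal_one, one_mul]
          rfl
      _ ≤ _ := mul_le_mul_right this _
  have e2 : ENNReal.ofReal (2 ^ j) * ENNReal.ofReal (((2 : ℝ) ^ k)⁻¹) =
      (2 : ℝ≥0∞) ^ ((j : ℝ) - k) := by
    rw [← ENNReal.ofReal_mul h2j.le, ENNReal.rpow_sub _ _ (by norm_num) (by norm_num),
      ENNReal.rpow_natCast, ENNReal.rpow_natCast, ← div_eq_mul_inv,
      ENNReal.ofReal_div_of_pos (by positivity), ENNReal.ofReal_pow (by norm_num),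
      ENNReal.ofReal_pow (by norm_num)]
    norm_num
  have hmain : ∫⁻ x, (‖χ ((2 : ℝ) ^ (k : ℤ) * ‖x‖)‖₊ : ℝ≥0∞) ^ p *
      sphMaxLoc d (𝓕⁻ g) x ^ p * wt d x ≤ C₁ * C₂ * (2 : ℝ≥0∞) ^ ((j : ℝ) - k) * N := by
    calc _ ≤ ∫⁻ x : EuclideanSpace ℝ (Fin d), (ENNReal.ofReal (2 ^ j) * (C₁ * N)) *
          (‖χ ((2 : ℝ) ^ (k : ℤ) * ‖x‖)‖ₑ ^ p * wt d x) := by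
          refine lintegral_mono fun x => ?_
          calc _ ≤ ‖χ ((2 : ℝ) ^ (k : ℤ) * ‖x‖)‖ₑ ^ p *
                (ENNReal.ofReal (2 ^ j) * (C₁ * N)) * wt d x := by
                gcongr
                · exact le_rfl
                · exact hM x
            _ = _ := by ring
      _ = (ENNReal.ofReal (2 ^ j) * (C₁ * N)) * ∫⁻ x : EuclideanSpace ℝ (Fin d),
          (‖χ ((2 : ℝ) ^ (k : ℤ) * ‖x‖)‖ₑ ^ p * wt d x) := by
          apply lintegral_const_mul
          unfold wt
          have := hχc.measurable
          fun_prop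
      _ ≤ (ENNReal.ofReal (2 ^ j) * (C₁ * N)) * (C₂ * ENNReal.ofReal (((2 : ℝ) ^ k)⁻¹)) := by
          gcongr
          exact H₂ k
      _ = _ := by rw [← e2]; ring
  calc _ ≤ (C₁ * C₂ * (2 : ℝ≥0∞) ^ ((j : ℝ) - k) * N) ^ (1 / p) :=
        ENNReal.rpow_le_rpow hmain (by positivity)
    _ = (C₁ * C₂) ^ (1 / p) * (2 : ℝ≥0∞) ^ (-(1 / p * ((k : ℝ) - (j : ℝ)))) * N ^ (1 / p) := by
        rw [ENNReal.mul_rpow_of_nonneg _ _ (by positivity),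
          ENNReal.mul_rpow_of_nonneg _ _ (by positivity), ← ENNReal.rpow_mul]
        congr 3
        ring
    _ ≤ _ := by
        gcongr
        rw [ENNReal.coe_add, ENNReal.coe_toNNReal hCfin]
        exact le_self_add

end
end
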